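/- arXiv:2007.15998 — 2 statements merged into one kernel-verified Lean document; each statement's English description precedes it below -/
import Mathlib

section
/- Consider the pathwise two-timescale gradient setup: f, g : ℝ^{d₁} × ℝ^{d₂} → ℝ are continuously differentiable with ∇_α f and ∇_β g locally Lipschitz; γ₁, γ₂ : [0,∞) → (0,∞) are nonincreasing continuous with lim_{t→∞} γ₁(t) = lim_{t→∞} γ₂(t) = lim_{t→∞} γ₁(t)/γ₂(t) = 0 and ∫₀^∞ γ₁(t) dt = ∫₀^∞ γ₂(t) dt = ∞; α : [0,∞) → ℝ^{d₁} and β : [0,∞) → ℝ^{d₂} are continuous with sup_{t≥0}(‖α(t)‖ + ‖β(t)‖) < ∞ and satisfy α(t) = α(0) − ∫₀^t γ₁(u) ∇_α f(α(u), β(u)) du − E₁(t) and β(t) = β(0) − ∫₀^t γ₂(u) ∇_β g(α(u), β(u)) du − E₂(t), where E₁ : [0,∞) → ℝ^{d₁} and E₂ : [0,∞) → ℝ^{d₂} are continuous noise paths that converge to finite limits as t → ∞. Suppose that for every α ∈ ℝ^{d₁} the ODE β̇ = −∇_β g(α, β) has a globally asymptotically stable equilibrium β*(α), and that the map β* : ℝ^{d₁}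 → ℝ^{d₂} is Lipschitz continuous. Then lim_{t→∞} ‖β(t) − β*(α(t))‖ = 0, and consequently lim_{t→∞} ∇_β g(α(t), β(t)) = 0. -/
open Filter

/-- The gradient of `f` in its first variable: `∇_α f(α, β)`. -/
noncomputable def gradFst {d₁ d₂ : ℕ}
    (f : EuclideanSpace ℝ (Fin d₁) × EuclideanSpace ℝ (Fin d₂) → ℝ)
    (α : EuclideanSpace ℝ (Fin d₁)) (β : EuclideanSpace ℝ (Fin d₂)) :
    EuclideanSpace ℝ (Fin d₁) :=
  gradient (fun a => f (a, β)) α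

/-- The gradient of `g` in its second variable: `∇_β g(α, β)`. -/
noncomputable def gradSnd {d₁ d₂ : ℕ}
    (g : EuclideanSpace ℝ (Fin d₁) × EuclideanSpace ℝ (Fin d₂) → ℝ)
    (α : EuclideanSpace ℝ (Fin d₁)) (β : EuclideanSpace ℝ (Fin d₂)) :
    EuclideanSpace ℝ (Fin d₂) :=
  gradient (fun b => g (α, b)) β

/-- `xstar` is a globally asymptotically stable equilibrium of the ODE `ẋ = -V(x)`:
it is an equilibrium, every solution converges to it, and it is Lyapunov stable. -/
def IsGloballyAsymptoticallyStable {d : ℕ}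
    (V : EuclideanSpace ℝ (Fin d) → EuclideanSpace ℝ (Fin d))
    (xstar : EuclideanSpace ℝ (Fin d)) : Prop :=
  V xstar = 0 ∧
  (∀ x : ℝ → EuclideanSpace ℝ (Fin d),
    (∀ t ≥ (0:ℝ), HasDerivAt x (-(V (x t))) t) → Tendsto x atTop (nhds xstar)) ∧
  (∀ ε > (0:ℝ), ∃ δ > (0:ℝ), ∀ x : ℝ → EuclideanSpace ℝ (Fin d),
    (∀ t ≥ (0:ℝ), HasDerivAt x (-(V (x t))) t) →
    ‖x 0 - xstar‖ < δ → ∀ t ≥ (0:ℝ), ‖x t - xstar‖ < ε)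

open Set Topology

/-- A quantity `H` which eventually increases at most at rate `o(1)` with respect to the clock `τ`,
decreases at a definite rate while `φ` is bounded below, and is controlled by `φ`, forces `φ` to
tend to zero. -/
theorem tendsto_zero_of_decrease {τ φ H : ℝ → ℝ} {L C B : ℝ} (hL : 0 < L) (hC : 0 < C)
    (hτc : ContinuousOn τ (Ici 0)) (hτm : MonotoneOn τ (Ici 0)) (hτ : Tendsto τ atTop atTop)
    (hφ0 : ∀ t, 0 ≤ φ t)
    (hφ : ∀ᶠ s in atTop, ∀ t ≥ s, φ s - φ t ≤ L * (τ t - τ s))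
    (hB : ∀ᶠ s in atTop, |H s| ≤ B)
    (hHφ : ∀ᶠ s in atTop, |H s| ≤ C * φ s)
    (hslow : ∀ κ > 0, ∀ᶠ s in atTop, ∀ t ≥ s, H t - H s ≤ κ * (τ t - τ s))
    (hdec : ∀ η > 0, ∃ δ > 0, ∀ᶠ s in atTop, ∀ t ≥ s, (∀ u ∈ Icc s t, η ≤ φ u) →
      H t - H s ≤ -δ * (τ t - τ s)) :
    Tendsto φ atTop (𝓝 0) := by
  have advance : ∀ s ≥ 0, ∀ w ≥ 0, ∃ t ≥ s, τ t = τ s + w := by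
    intro s hs w hw
    obtain ⟨t', hle, hst⟩ :=
      ((hτ.eventually_ge_atTop (τ s + w)).and (eventually_ge_atTop s)).exists
    obtain ⟨t, ht, hτt⟩ := intermediate_value_Icc hst
      (hτc.mono fun u hu => hs.le.trans hu.1) (show τ s + w ∈ Icc (τ s) (τ t') from
        ⟨by linarith, hle⟩)
    exact ⟨t, ht.1, hτt⟩
  suffices h : ∀ ε > 0, ∀ᶠ t in atTop, φ t < ε by
    refine tendsto_order.2 ⟨fun a ha => .of_forall fun t => ha.trans_le (hφ0 t), fun a ha => h a ha⟩
  intro ε hε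
  obtain ⟨δ₁, hδ₁, hdec₁⟩ := hdec (ε / 2) (half_pos hε)
  set c := ε / (2 * L) with hc
  have hcpos : 0 < c := by positivity
  have hLc : L * c = ε / 2 := by rw [hc]; field_simp
  set D := δ₁ * c with hD
  have hDpos : 0 < D := by positivity
  set η := D / (4 * C) with hη
  have hηpos : 0 < η := by positivity
  have hCη : C * η = D / 4 := by rw [hη]; field_simp
  obtain ⟨δ₂, hδ₂, hdec₂⟩ := hdec η hηpos
  have hB0 : 0 ≤ B := by
    obtain ⟨s, hs⟩ := hB.exists
    exact (abs_nonneg _).trans hs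
  set W := 2 * B / δ₂ + 1 with hW
  have hWpos : 0 < W := by positivity
  have hδW : δ₂ * W = 2 * B + δ₂ := by rw [hW]; field_simp
  set κ := D / (8 * W) with hκ
  have hκpos : 0 < κ := by positivity
  have hκW : κ * W = D / 8 := by rw [hκ]; field_simp
  obtain ⟨T, hT⟩ := eventually_atTop.1 ((eventually_ge_atTop (0 : ℝ)).and
    (hφ.and (hB.and (hHφ.and ((hslow κ hκpos).and (hdec₁.and hdec₂))))))
  have visit : ∀ s ≥ T, ∀ t ≥ s, τ t = τ s + W → ∃ u ∈ Icc s t, φ u < η := by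
    intro s hs t hst hτt
    by_contra! hcon
    have h₁ := (hT s hs).2.2.2.2.2.2 t hst hcon
    have h₂ := abs_le.1 (hT s hs).2.2.1
    have h₃ := abs_le.1 (hT t (hs.le.trans hst)).2.2.1
    have : τ t - τ s = W := by linarith
    rw [this, neg_mul, hδW] at h₁
    linarith [h₂.2, h₃.1]
  have small : ∀ u ≥ T, φ u < η → |H u| ≤ D / 4 := fun u hu hφu =>
    (hT u hu).2.2.2.1.trans (by rw [← hCη]; gcongr)
  have hT0 : 0 ≤ T := (hT T le_rfl).1
  filter_upwards [eventually_ge_atTop T, hτ.eventually_ge_atTop (τ T + W)] with t hTt hτt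
  by_contra! hφt
  obtain ⟨t', ht', hτt'⟩ := intermediate_value_Icc hTt
    (hτc.mono fun u hu => hT0.trans hu.1) (show τ t - W ∈ Icc (τ T) (τ t) from
      ⟨by linarith, by linarith⟩)
  obtain ⟨u, hu, hφu⟩ := visit t' ht'.1 t ht'.2 (by linarith)
  have huT : T ≤ u := ht'.1.trans hu.1
  obtain ⟨t₁, htt₁, hτt₁⟩ := advance t (hT0.trans hTt) c hcpos.le
  obtain ⟨t₂, ht₁₂, hτt₂⟩ := advance t₁ (hT0.trans (hTt.trans htt₁)) W hWpos.le
  obtain ⟨v, hv, hφv⟩ := visit t₁ (hTt.trans htt₁) t₂ ht₁₂ hτt₂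
  have hvT : T ≤ v := hTt.trans (htt₁.trans hv.1)
  have e₁ := (abs_le.1 (small u huT hφu)).2
  have e₂ := (abs_le.1 (small v hvT hφv)).1
  have e₃ : H t - H u ≤ D / 8 := by
    refine ((hT u huT).2.2.2.2.1 t hu.2).trans ?_
    rw [← hκW]
    have := hτm (hT0.trans ht'.1) (hT0.trans huT) hu.1
    gcongr
    linarith
  have e₄ : H v - H t₁ ≤ D / 8 := by
    refine ((hT t₁ (hTt.trans htt₁)).2.2.2.2.1 v hv.1).trans ?_
    rw [← hκW]
    have := hτm (hT0.trans hvT) (hT0.trans (hvT.trans hv.2)) hv.2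
    gcongr
    linarith
  have e₅ : H t₁ - H t ≤ -D := by
    have := (hT t hTt).2.2.2.2.2.1 t₁ htt₁ ?_
    · rw [hτt₁] at this
      linarith
    · intro w hw
      have h₁ := (hT t hTt).2.1 w hw.1
      have h₂ := hτm (hT0.trans (hTt.trans hw.1)) (hT0.trans (hTt.trans htt₁)) hw.2
      have h₃ : L * (τ w - τ t) ≤ L * c := by gcongr; linarith
      linarith
  linarith

theorem norm_sub_le_of_norm_deriv_le_mul {E : Type*} [NormedAddCommGroup E] [NormedSpace ℝ E]
    {x x' : ℝ → E} {τ γ : ℝ → ℝ} {s t c : ℝ} (hst : s ≤ t)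
    (hx : ∀ u ∈ Icc s t, HasDerivAt x (x' u) u) (hτ : ∀ u ∈ Icc s t, HasDerivAt τ (γ u) u)
    (hb : ∀ u ∈ Icc s t, ‖x' u‖ ≤ c * γ u) : ‖x t - x s‖ ≤ c * (τ t - τ s) := by
  have hB : ∀ u ∈ Icc s t, HasDerivAt (fun v => c * (τ v - τ s)) (c * γ u) u := fun u hu =>
    ((hτ u hu).sub_const _).const_mul c
  have hf : ∀ u ∈ Icc s t, HasDerivAt (fun v => x v - x s) (x' u) u := fun u hu =>
    (hx u hu).sub_const _
  exact image_norm_le_of_norm_deriv_right_le_deriv_boundary'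
    (fun u hu => (hf u hu).continuousAt.continuousWithinAt)
    (fun u hu => (hf u (Ico_subset_Icc_self hu)).hasDerivWithinAt) (by simp)
    (fun u hu => (hB u hu).continuousAt.continuousWithinAt)
    (fun u hu => (hB u (Ico_subset_Icc_self hu)).hasDerivWithinAt)
    (fun u hu => hb u (Ico_subset_Icc_self hu)) (right_mem_Icc.2 hst)

theorem sub_le_of_deriv_le_mul {G G' τ γ : ℝ → ℝ} {s t c : ℝ} (hst : s ≤ t)
    (hG : ∀ u ∈ Icc s t, HasDerivAt G (G' u) u) (hτ : ∀ u ∈ Icc s t, HasDerivAt τ (γ u) u)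
    (hb : ∀ u ∈ Icc s t, G' u ≤ c * γ u) : G t - G s ≤ c * (τ t - τ s) := by
  have hB : ∀ u ∈ Icc s t, HasDerivAt (fun v => c * (τ v - τ s)) (c * γ u) u := fun u hu =>
    ((hτ u hu).sub_const _).const_mul c
  have hf : ∀ u ∈ Icc s t, HasDerivAt (fun v => G v - G s) (G' u) u := fun u hu =>
    (hG u hu).sub_const _
  exact image_le_of_deriv_right_le_deriv_boundary
    (fun u hu => (hf u hu).continuousAt.continuousWithinAt)
    (fun u hu => (hf u (Ico_subset_Icc_self hu)).hasDerivWithinAt) (by simp)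
    (fun u hu => (hB u hu).continuousAt.continuousWithinAt)
    (fun u hu => (hB u (Ico_subset_Icc_self hu)).hasDerivWithinAt)
    (fun u hu => hb u (Ico_subset_Icc_self hu)) (right_mem_Icc.2 hst)

theorem hasDerivAt_integral_of_continuousOn_Ici {E : Type*} [NormedAddCommGroup E]
    [NormedSpace ℝ E] [CompleteSpace E] {F : ℝ → E} {a t : ℝ} (hF : ContinuousOn F (Ici a))
    (ht : a < t) : HasDerivAt (fun v => ∫ u in a..v, F u) (F t) t := by
  refine intervalIntegral.integral_hasDerivAt_right ?_ ?_ (hF.continuousAt (Ici_mem_nhds ht))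
  · refine (hF.mono ?_).intervalIntegrable
    rw [uIcc_of_le ht.le]
    exact Icc_subset_Ici_self
  · exact (hF.mono Ioi_subset_Ici_self).stronglyMeasurableAtFilter isOpen_Ioi t ht

theorem hasDerivAt_of_eq_const_sub_integral {E : Type*} [NormedAddCommGroup E]
    [NormedSpace ℝ E] [CompleteSpace E] {F x : ℝ → E} {c : E} {t : ℝ}
    (hF : ContinuousOn F (Ici 0)) (hx : ∀ t ≥ (0 : ℝ), x t = c - ∫ u in (0 : ℝ)..t, F u)
    (ht : 0 < t) : HasDerivAt x (-F t) t := by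
  refine ((hasDerivAt_integral_of_continuousOn_Ici hF ht).const_sub c).congr_of_eventuallyEq ?_
  filter_upwards [Ici_mem_nhds ht] with u hu using hx u hu

theorem IsGloballyAsymptoticallyStable.eq_of_apply_eq_zero {d : ℕ}
    {V : EuclideanSpace ℝ (Fin d) → EuclideanSpace ℝ (Fin d)} {x b : EuclideanSpace ℝ (Fin d)}
    (h : IsGloballyAsymptoticallyStable V x) (hb : V b = 0) : b = x := by
  refine tendsto_nhds_unique tendsto_const_nhds (h.2.1 (fun _ => b) fun t _ => ?_)
  simpa [hb] using hasDerivAt_const t b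

theorem fderiv_apply_zero_prod {d₁ d₂ : ℕ}
    {g : EuclideanSpace ℝ (Fin d₁) × EuclideanSpace ℝ (Fin d₂) → ℝ} (hg : Differentiable ℝ g)
    (a : EuclideanSpace ℝ (Fin d₁)) (b w : EuclideanSpace ℝ (Fin d₂)) :
    fderiv ℝ g (a, b) (0, w) = inner ℝ (gradSnd g a b) w := by
  have h := (hg (a, b)).hasFDerivAt.comp b (hasFDerivAt_prodMk_right a b)
  rw [gradSnd, inner_gradient_left]
  exact (congrArg (fun L => L w) h.fderiv).symm

/-- Adding a perturbation that tends to zero keeps a bounded curve eventually in a slightly larger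
ball. -/
theorem eventually_norm_add_sub_le {E : Type*} [NormedAddCommGroup E] {x e : ℝ → E} {l : E} {M : ℝ}
    (hx : ∀ t ≥ (0 : ℝ), ‖x t‖ ≤ M) (he : Tendsto e atTop (𝓝 l)) :
    ∀ᶠ t in atTop, ‖x t + (e t - l)‖ ≤ M + 1 := by
  have h : Tendsto (fun t => ‖e t - l‖) atTop (𝓝 0) := by
    simpa using (he.sub_const l).norm
  filter_upwards [eventually_ge_atTop 0, h.eventually_le_const one_pos] with t ht h₁
  exact (norm_add_le _ _).trans (add_le_add (hx t ht) h₁)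

theorem stmt10 {d₁ d₂ : ℕ} (hd₁ : 1 ≤ d₁) (hd₂ : 1 ≤ d₂)
    (f g : EuclideanSpace ℝ (Fin d₁) × EuclideanSpace ℝ (Fin d₂) → ℝ)
    (hf : ContDiff ℝ 1 f) (hg : ContDiff ℝ 1 g)
    (hfLip : LocallyLipschitz (fun p :
      EuclideanSpace ℝ (Fin d₁) × EuclideanSpace ℝ (Fin d₂) => gradFst f p.1 p.2))
    (hgLip : LocallyLipschitz (fun p :
      EuclideanSpace ℝ (Fin d₁) × EuclideanSpace ℝ (Fin d₂) => gradSnd g p.1 p.2))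
    (γ₁ γ₂ : ℝ → ℝ)
    (hγ₁pos : ∀ t ≥ (0:ℝ), 0 < γ₁ t) (hγ₂pos : ∀ t ≥ (0:ℝ), 0 < γ₂ t)
    (hγ₁anti : AntitoneOn γ₁ (Set.Ici (0:ℝ))) (hγ₂anti : AntitoneOn γ₂ (Set.Ici (0:ℝ)))
    (hγ₁cont : ContinuousOn γ₁ (Set.Ici (0:ℝ))) (hγ₂cont : ContinuousOn γ₂ (Set.Ici (0:ℝ)))
    (hγ₁lim : Tendsto γ₁ atTop (nhds 0)) (hγ₂lim : Tendsto γ₂ atTop (nhds 0))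
    (hratio : Tendsto (fun t => γ₁ t / γ₂ t) atTop (nhds 0))
    (hγ₁div : Tendsto (fun t => ∫ u in (0:ℝ)..t, γ₁ u) atTop atTop)
    (hγ₂div : Tendsto (fun t => ∫ u in (0:ℝ)..t, γ₂ u) atTop atTop)
    (α : ℝ → EuclideanSpace ℝ (Fin d₁)) (β : ℝ → EuclideanSpace ℝ (Fin d₂))
    (hαcont : ContinuousOn α (Set.Ici (0:ℝ))) (hβcont : ContinuousOn β (Set.Ici (0:ℝ)))
    (hbdd : ∃ M : ℝ, ∀ t ≥ (0:ℝ), ‖α t‖ + ‖β t‖ ≤ M)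
    (E₁ : ℝ → EuclideanSpace ℝ (Fin d₁)) (E₂ : ℝ → EuclideanSpace ℝ (Fin d₂))
    (hE₁cont : Continuous E₁) (hE₂cont : Continuous E₂)
    (hE₁lim : ∃ l₁, Tendsto E₁ atTop (nhds l₁))
    (hE₂lim : ∃ l₂, Tendsto E₂ atTop (nhds l₂))
    (hαeq : ∀ t ≥ (0:ℝ),
      α t = α 0 - (∫ u in (0:ℝ)..t, γ₁ u • gradFst f (α u) (β u)) - E₁ t)
    (hβeq : ∀ t ≥ (0:ℝ),
      β t = β 0 - (∫ u in (0:ℝ)..t, γ₂ u • gradSnd g (α u) (β u)) - E₂ t)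
    (bstar : EuclideanSpace ℝ (Fin d₁) → EuclideanSpace ℝ (Fin d₂))
    (hGAS : ∀ a, IsGloballyAsymptoticallyStable (fun b => gradSnd g a b) (bstar a))
    (hbstarLip : ∃ Λ : NNReal, LipschitzWith Λ bstar) :
    Tendsto (fun t => ‖β t - bstar (α t)‖) atTop (nhds 0) ∧
    Tendsto (fun t => gradSnd g (α t) (β t)) atTop (nhds 0) := by
  obtain ⟨M, hM⟩ := hbdd
  obtain ⟨l₁, hl₁⟩ := hE₁lim
  obtain ⟨l₂, hl₂⟩ := hE₂lim
  obtain ⟨Λ, hΛ⟩ := hbstarLip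
  have hαM : ∀ t ≥ (0 : ℝ), ‖α t‖ ≤ M := fun t ht => by linarith [hM t ht, norm_nonneg (β t)]
  have hβM : ∀ t ≥ (0 : ℝ), ‖β t‖ ≤ M := fun t ht => by linarith [hM t ht, norm_nonneg (α t)]
  set F := fun p : EuclideanSpace ℝ (Fin d₁) × EuclideanSpace ℝ (Fin d₂) => gradFst f p.1 p.2
    with hF
  set V := fun p : EuclideanSpace ℝ (Fin d₁) × EuclideanSpace ℝ (Fin d₂) => gradSnd g p.1 p.2
    with hV
  set τ : ℝ → ℝ := fun t => ∫ u in (0 : ℝ)..t, γ₂ u with hτ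
  set a := fun t => α t + (E₁ t - l₁) with ha
  set y := fun t => β t + (E₂ t - l₂) with hy
  have hαβ : ContinuousOn (fun t => (α t, β t)) (Ici 0) := hαcont.prodMk hβcont
  have hτ' : ∀ t > 0, HasDerivAt τ (γ₂ t) t := fun t ht =>
    hasDerivAt_integral_of_continuousOn_Ici hγ₂cont ht
  have ha' : ∀ t > 0, HasDerivAt a (-(γ₁ t • F (α t, β t))) t := fun t ht =>
    hasDerivAt_of_eq_const_sub_integral (F := fun t => γ₁ t • F (α t, β t)) (c := α 0 - l₁)
      (hγ₁cont.smul (hfLip.continuous.comp_continuousOn hαβ))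
      (fun t ht => by simp only [ha, hF]; rw [hαeq t ht]; abel) ht
  have hy' : ∀ t > 0, HasDerivAt y (-(γ₂ t • V (α t, β t))) t := fun t ht =>
    hasDerivAt_of_eq_const_sub_integral (F := fun t => γ₂ t • V (α t, β t)) (c := β 0 - l₂)
      (hγ₂cont.smul (hgLip.continuous.comp_continuousOn hαβ))
      (fun t ht => by simp only [hy, hV]; rw [hβeq t ht]; abel) ht
  have hint : ∀ s ≥ (0 : ℝ), ∀ t ≥ s, IntervalIntegrable γ₂ MeasureTheory.volume s t :=
    fun s hs t hst => (hγ₂cont.mono (by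
      rw [uIcc_of_le hst]; exact fun u hu => hs.le.trans hu.1)).intervalIntegrable
  have hτm : MonotoneOn τ (Ici 0) := by
    intro s hs t ht hst
    have h₁ := intervalIntegral.integral_add_adjacent_intervals (hint 0 le_rfl s hs)
      (hint s hs t hst)
    have h₂ : 0 ≤ ∫ u in s..t, γ₂ u := intervalIntegral.integral_nonneg hst fun u hu =>
      (hγ₂pos u (le_trans hs hu.1)).le
    simp only [hτ]
    linarith
  have hτc : ContinuousOn τ (Ici 0) := by
    intro t ht
    have ht1 : (0 : ℝ) ≤ t + 1 := le_trans ht (by linarith)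
    have hc := intervalIntegral.continuousOn_primitive_interval'
      (hint 0 le_rfl (t + 1) ht1) left_mem_uIcc
    rw [uIcc_of_le ht1] at hc
    refine (hc t ⟨ht, by linarith⟩).mono_of_mem_nhdsWithin ?_
    filter_upwards [self_mem_nhdsWithin, mem_nhdsWithin_of_mem_nhds (Iic_mem_nhds (lt_add_one t))]
      with u h₁ h₂ using ⟨h₁, h₂⟩
  let R₁ := M + 1
  let R₂ := max R₁ (‖bstar 0‖ + Λ * R₁)
  let K : Set (EuclideanSpace ℝ (Fin d₁) × EuclideanSpace ℝ (Fin d₂)) :=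
    Metric.closedBall 0 R₁ ×ˢ Metric.closedBall 0 R₂
  have hKc : IsCompact K := (isCompact_closedBall _ _).prod (isCompact_closedBall _ _)
  have hbK : ∀ x, ‖x‖ ≤ R₁ → (x, bstar x) ∈ K := by
    intro x hx
    refine ⟨by simpa using hx, ?_⟩
    have h₁ : ‖bstar x - bstar 0‖ ≤ Λ * ‖x‖ := by simpa using hΛ.norm_sub_le x 0
    have h₂ : (Λ : ℝ) * ‖x‖ ≤ Λ * R₁ := by gcongr
    have h₃ := norm_le_insert' (bstar x) (bstar 0)
    rw [mem_closedBall_zero_iff]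
    exact le_max_of_le_right (by linarith)
  have haR : ∀ᶠ t in atTop, ‖a t‖ ≤ R₁ := eventually_norm_add_sub_le hαM hl₁
  have hp : ∀ᶠ t in atTop, (a t, y t) ∈ K := by
    filter_upwards [haR, eventually_norm_add_sub_le hβM hl₂] with t h₁ h₂
    exact ⟨mem_closedBall_zero_iff.2 h₁, mem_closedBall_zero_iff.2 (le_max_of_le_left h₂)⟩
  have hq : ∀ t ≥ 0, (α t, β t) ∈ K := by
    intro t ht
    have h₁ := hαM t ht
    have h₂ := hβM t ht
    exact ⟨mem_closedBall_zero_iff.2 (by linarith),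
      mem_closedBall_zero_iff.2 (le_max_of_le_left (by linarith))⟩
  obtain ⟨CV, hCV⟩ := (hgLip.locallyLipschitzOn (s := K)).exists_lipschitzOnWith_of_compact hKc
  obtain ⟨Cg, hCg⟩ :=
    (hg.locallyLipschitz.locallyLipschitzOn (s := K)).exists_lipschitzOnWith_of_compact hKc
  have hloc : LocallyLipschitz fun x => g (x, bstar x) :=
    hg.locallyLipschitz.comp (LocallyLipschitz.id.prodMk hΛ.locallyLipschitz)
  obtain ⟨Ch, hCh⟩ := (hloc.locallyLipschitzOn
    (s := Metric.closedBall 0 R₁)).exists_lipschitzOnWith_of_compact (isCompact_closedBall _ _)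
  obtain ⟨NF, hNF⟩ := hKc.exists_bound_of_continuousOn hfLip.continuous.continuousOn
  obtain ⟨NV, hNV⟩ := hKc.exists_bound_of_continuousOn hgLip.continuous.continuousOn
  obtain ⟨ND, hND⟩ := hKc.exists_bound_of_continuousOn
    (hg.continuous_fderiv one_ne_zero).continuousOn
  obtain ⟨Ng, hNg⟩ := hKc.exists_bound_of_continuousOn hg.continuous.continuousOn
  have hne : (α 0, β 0) ∈ K := hq 0 le_rfl
  have hNF0 : 0 ≤ NF := (norm_nonneg _).trans (hNF _ hne)
  have hNV0 : 0 ≤ NV := (norm_nonneg _).trans (hNV _ hne)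
  have hND0 : 0 ≤ ND := (norm_nonneg _).trans (hND _ hne)
  have hrate : ∀ κ > 0, ∀ᶠ t in atTop, γ₁ t ≤ κ * γ₂ t := by
    intro κ hκ
    filter_upwards [hratio.eventually_le_const hκ, eventually_ge_atTop 0] with t h ht
    exact (div_le_iff₀ (hγ₂pos t ht)).1 h
  have haslow : ∀ κ > 0, ∀ᶠ s in atTop, ∀ t ≥ s, ‖a t - a s‖ ≤ κ * (τ t - τ s) := by
    intro κ hκ
    obtain ⟨T, hT⟩ := eventually_atTop.1
      ((hrate (κ / (NF + 1)) (by positivity)).and (eventually_gt_atTop 0))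
    filter_upwards [eventually_ge_atTop T] with s hs t hst
    refine norm_sub_le_of_norm_deriv_le_mul hst
      (fun u hu => ha' u (hT u (hs.trans hu.1)).2) (fun u hu => hτ' u (hT u (hs.trans hu.1)).2) ?_
    intro u hu
    obtain ⟨h₁, h₂⟩ := hT u (hs.trans hu.1)
    have h₃ := (hγ₁pos u h₂.le).le
    have h₄ := hγ₂pos u h₂.le
    rw [norm_neg, norm_smul, Real.norm_of_nonneg h₃]
    calc γ₁ u * ‖F (α u, β u)‖ ≤ κ / (NF + 1) * γ₂ u * (NF + 1) := by
          gcongr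
          linarith [hNF _ (hq u h₂.le)]
      _ = κ * γ₂ u := by field_simp
  have hyslow : ∀ᶠ s in atTop, ∀ t ≥ s, ‖y t - y s‖ ≤ NV * (τ t - τ s) := by
    filter_upwards [eventually_gt_atTop 0] with s hs t hst
    refine norm_sub_le_of_norm_deriv_le_mul hst
      (fun u hu => hy' u (hs.trans_le hu.1)) (fun u hu => hτ' u (hs.trans_le hu.1)) ?_
    intro u hu
    have hu0 : 0 < u := hs.trans_le hu.1
    have h₄ := (hγ₂pos u hu0.le).le
    rw [norm_neg, norm_smul, Real.norm_of_nonneg h₄, mul_comm]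
    gcongr
    exact hNV _ (hq u hu0.le)
  have hE₁ : Tendsto (fun t => ‖E₁ t - l₁‖) atTop (𝓝 0) := by simpa using (hl₁.sub_const l₁).norm
  have hE₂ : Tendsto (fun t => ‖E₂ t - l₂‖) atTop (𝓝 0) := by simpa using (hl₂.sub_const l₂).norm
  have hVpq : Tendsto (fun t => ‖V (a t, y t) - V (α t, β t)‖) atTop (𝓝 0) := by
    have hlim : Tendsto (fun t => CV * max ‖E₁ t - l₁‖ ‖E₂ t - l₂‖) atTop (𝓝 0) := by
      simpa using (hE₁.max hE₂).const_mul (CV : ℝ)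
    refine squeeze_zero' (.of_forall fun _ => norm_nonneg _) ?_ hlim
    filter_upwards [hp, eventually_ge_atTop 0] with t h₁ h₂
    simpa [ha, hy, Prod.norm_def] using hCV.norm_sub_le h₁ (hq t h₂)
  set φ := fun t => ‖y t - bstar (a t)‖
  set H := fun t => g (a t, y t) - g (a t, bstar (a t)) with hH
  have hG' : ∀ t > 0, HasDerivAt (fun t => g (a t, y t))
      (fderiv ℝ g (a t, y t) (-(γ₁ t • F (α t, β t)), -(γ₂ t • V (α t, β t)))) t := fun t ht =>
    ((hg.differentiable one_ne_zero) (a t, y t)).hasFDerivAt.comp_hasDerivAt t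
      ((ha' t ht).prodMk (hy' t ht))
  have hG'_le : ∀ κ > 0, ∀ᶠ t in atTop,
      fderiv ℝ g (a t, y t) (-(γ₁ t • F (α t, β t)), -(γ₂ t • V (α t, β t))) ≤
        (κ - ‖V (a t, y t)‖ ^ 2) * γ₂ t := by
    intro κ hκ
    set r := κ / (ND * NF + NV + 1) with hr
    have hr0 : 0 < r := by positivity
    have hrκ : r * (ND * NF + NV) ≤ κ := by
      rw [hr, div_mul_eq_mul_div, div_le_iff₀ (by positivity)]
      nlinarith
    filter_upwards [hp, eventually_ge_atTop 0, hrate r hr0, hVpq.eventually_le_const hr0]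
      with t hpt ht hγ hVt
    have h₃ := (hγ₁pos t ht).le
    have h₄ := (hγ₂pos t ht).le
    have e₁ : fderiv ℝ g (a t, y t) (-(γ₁ t • F (α t, β t)), 0) ≤ r * γ₂ t * (ND * NF) := by
      calc _ ≤ ‖fderiv ℝ g (a t, y t) (-(γ₁ t • F (α t, β t)), 0)‖ := Real.le_norm_self _
        _ ≤ ‖fderiv ℝ g (a t, y t)‖ * (γ₁ t * ‖F (α t, β t)‖) := by
          refine (ContinuousLinearMap.le_opNorm _ _).trans (le_of_eq ?_)
          rw [Prod.norm_def, norm_neg, norm_zero, max_eq_left (norm_nonneg _), norm_smul,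
            Real.norm_of_nonneg h₃]
        _ ≤ ND * (r * γ₂ t * NF) := by
          gcongr
          exacts [hND _ hpt, hNF _ (hq t ht)]
        _ = _ := by ring
    have e₂ : fderiv ℝ g (a t, y t) (0, -(γ₂ t • V (α t, β t))) ≤
        γ₂ t * (r * NV - ‖V (a t, y t)‖ ^ 2) := by
      rw [fderiv_apply_zero_prod (hg.differentiable one_ne_zero)]
      change inner ℝ (V (a t, y t)) _ ≤ _
      rw [inner_neg_right, inner_smul_right, ← mul_neg]
      gcongr
      have h₅ := real_inner_le_norm (V (a t, y t)) (V (a t, y t) - V (α t, β t))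
      rw [inner_sub_right, real_inner_self_eq_norm_sq] at h₅
      have h₆ : ‖V (a t, y t)‖ * ‖V (a t, y t) - V (α t, β t)‖ ≤ NV * r := by
        gcongr
        exact hNV _ hpt
      linarith
    have e₃ : ((-(γ₁ t • F (α t, β t)), -(γ₂ t • V (α t, β t))) :
        EuclideanSpace ℝ (Fin d₁) × EuclideanSpace ℝ (Fin d₂)) =
        (-(γ₁ t • F (α t, β t)), 0) + (0, -(γ₂ t • V (α t, β t))) := by simp
    rw [e₃, map_add]
    nlinarith [mul_le_mul_of_nonneg_right hrκ h₄]
  have hHdec : ∀ κ > 0, ∀ᶠ s in atTop, ∀ t ≥ s, ∀ δ,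
      (∀ u ∈ Icc s t, δ ≤ ‖V (a u, y u)‖ ^ 2) → H t - H s ≤ (κ - δ) * (τ t - τ s) := by
    intro κ hκ
    obtain ⟨T, hT⟩ := eventually_atTop.1
      ((hG'_le (κ / 2) (half_pos hκ)).and ((eventually_gt_atTop 0).and
        (haR.and (haslow (κ / (2 * (Ch + 1))) (by positivity)))))
    filter_upwards [eventually_ge_atTop T] with s hs t hst δ hδ
    have h₁ : g (a t, y t) - g (a s, y s) ≤ (κ / 2 - δ) * (τ t - τ s) := by
      refine sub_le_of_deriv_le_mul (G := fun t => g (a t, y t)) hst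
        (fun u hu => hG' u (hT u (hs.trans hu.1)).2.1)
        (fun u hu => hτ' u (hT u (hs.trans hu.1)).2.1) fun u hu => ?_
      obtain ⟨h₁, h₂, -⟩ := hT u (hs.trans hu.1)
      refine h₁.trans ?_
      have := (hγ₂pos u h₂.le).le
      gcongr
      exact hδ u hu
    have h₂ : g (a s, bstar (a s)) - g (a t, bstar (a t)) ≤ κ / 2 * (τ t - τ s) := by
      have h₃ := hCh.norm_sub_le (mem_closedBall_zero_iff.2 (hT s hs).2.2.1)
        (mem_closedBall_zero_iff.2 (hT t (hs.trans hst)).2.2.1)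
      have h₄ := (hT s hs).2.2.2 t hst
      rw [norm_sub_rev] at h₄
      have h₅ := (Real.le_norm_self _).trans h₃
      refine h₅.trans ?_
      calc (Ch : ℝ) * ‖a s - a t‖ ≤ (Ch + 1) * (κ / (2 * (Ch + 1)) * (τ t - τ s)) := by
            gcongr
            linarith
        _ = κ / 2 * (τ t - τ s) := by field_simp
    simp only [hH]
    linarith
  have hgap : ∀ η > 0, ∃ δ > 0, ∀ p ∈ K, η ≤ ‖p.2 - bstar p.1‖ → δ ≤ ‖V p‖ := by
    intro η hη
    have hcl : IsClosed {p : EuclideanSpace ℝ (Fin d₁) × EuclideanSpace ℝ (Fin d₂) |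
        η ≤ ‖p.2 - bstar p.1‖} :=
      isClosed_le continuous_const
        (continuous_snd.sub (hΛ.continuous.comp continuous_fst)).norm
    obtain ⟨δ, hδ, h⟩ := (hKc.inter_right hcl).exists_forall_le'
      (hgLip.continuous.norm.continuousOn) (a := 0) (by
        rintro p ⟨-, hp⟩
        refine norm_pos_iff.2 fun h0 => ?_
        have := (hGAS p.1).eq_of_apply_eq_zero h0
        rw [mem_ofPred_eq, this, sub_self, norm_zero] at hp
        linarith)
    exact ⟨δ, hδ, fun p hpK hp => h p ⟨hpK, hp⟩⟩
  have hφ_lim : Tendsto φ atTop (𝓝 0) := by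
    refine tendsto_zero_of_decrease (τ := τ) (H := H) (L := NV + Λ + 1) (C := Cg + 1)
      (B := Ng + Ng) (by positivity) (by positivity) hτc hτm hγ₂div
      (fun t => norm_nonneg _) ?_ ?_ ?_ ?_ ?_
    · filter_upwards [haslow 1 one_pos, hyslow, eventually_ge_atTop 0] with s h₁ h₂ hs t hst
      have h₃ : φ s - φ t ≤ ‖(y s - bstar (a s)) - (y t - bstar (a t))‖ := norm_sub_norm_le _ _
      have h₄ : ‖(y s - bstar (a s)) - (y t - bstar (a t))‖ ≤
          ‖y t - y s‖ + ‖bstar (a t) - bstar (a s)‖ := by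
        rw [sub_sub_sub_comm, norm_sub_rev (y t), norm_sub_rev (bstar (a t))]
        exact norm_sub_le _ _
      have h₅ := hΛ.norm_sub_le (a t) (a s)
      have h₆ : (Λ : ℝ) * ‖a t - a s‖ ≤ Λ * (1 * (τ t - τ s)) := by
        gcongr
        exact h₁ t hst
      have h₇ := hτm hs (le_trans hs hst) hst
      linarith [h₂ t hst]
    · filter_upwards [hp, haR] with t h₁ h₂
      exact (norm_sub_le _ _).trans (add_le_add (hNg _ h₁) (hNg _ (hbK _ h₂)))
    · filter_upwards [hp, haR] with t h₁ h₂
      have h₃ := hCg.norm_sub_le h₁ (hbK _ h₂)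
      simp only [Prod.mk_sub_mk, sub_self, Prod.norm_def, norm_zero, norm_nonneg,
        max_eq_right] at h₃
      exact h₃.trans (by gcongr; linarith)
    · intro κ hκ
      filter_upwards [hHdec κ hκ] with s h t hst
      simpa using h t hst 0 fun u _ => sq_nonneg _
    · intro η hη
      obtain ⟨δ, hδ, hgapδ⟩ := hgap η hη
      refine ⟨δ ^ 2 / 2, by positivity, ?_⟩
      obtain ⟨T, hT⟩ := eventually_atTop.1 hp
      filter_upwards [hHdec (δ ^ 2 / 2) (by positivity), eventually_ge_atTop T] with s h hs t hst hu
      refine (h t hst (δ ^ 2) fun u hut => ?_).trans (le_of_eq (by ring))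
      exact pow_le_pow_left₀ hδ.le (hgapδ _ (hT u (hs.trans hut.1)) (hu u hut)) 2
  have hmain : Tendsto (fun t => ‖β t - bstar (α t)‖) atTop (𝓝 0) := by
    have hlim : Tendsto (fun t => φ t + ‖E₂ t - l₂‖ + Λ * ‖E₁ t - l₁‖) atTop (𝓝 0) := by
      simpa using (hφ_lim.add hE₂).add (hE₁.const_mul (Λ : ℝ))
    refine squeeze_zero (fun _ => norm_nonneg _) (fun t => ?_) hlim
    have h₁ : β t - bstar (α t) =
        (y t - bstar (a t)) - (E₂ t - l₂) + (bstar (a t) - bstar (α t)) := by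
      simp only [hy]; abel
    have h₂ : ‖bstar (a t) - bstar (α t)‖ ≤ Λ * ‖E₁ t - l₁‖ := by
      simpa [ha] using hΛ.norm_sub_le (a t) (α t)
    rw [h₁]
    exact (norm_add_le _ _).trans (add_le_add (norm_sub_le _ _) h₂)
  refine ⟨hmain, ?_⟩
  rw [tendsto_zero_iff_norm_tendsto_zero]
  have hlim : Tendsto (fun t => CV * ‖β t - bstar (α t)‖) atTop (𝓝 0) := by
    simpa using hmain.const_mul (CV : ℝ)
  refine squeeze_zero' (.of_forall fun _ => norm_nonneg _) ?_ hlim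
  filter_upwards [eventually_ge_atTop 0] with t ht
  have h₁ := hCV.norm_sub_le (hq t ht) (hbK (α t) ((hαM t ht).trans (by linarith)))
  have h₂ : V (α t, bstar (α t)) = 0 := (hGAS (α t)).1
  simpa [h₂, Prod.norm_def] using h₁
end

section
/- Consider the pathwise two-timescale gradient setup: f, g : ℝ^{d₁} × ℝ^{d₂} → ℝ are continuously differentiable with ∇_α f and ∇_β g locally Lipschitz; γ₁, γ₂ : [0,∞) → (0,∞) are nonincreasing continuous with lim_{t→∞} γ₁(t) = lim_{t→∞} γ₂(t) = lim_{t→∞} γ₁(t)/γ₂(t) = 0 and ∫₀^∞ γ₁(t) dt = ∫₀^∞ γ₂(t) dt = ∞; α : [0,∞) → ℝ^{d₁} and β : [0,∞) → ℝ^{d₂} are continuous with sup_{t≥0}(‖α(t)‖ + ‖β(t)‖) < ∞ and satisfy α(t) = α(0) − ∫₀^t γ₁(u) ∇_α f(α(u), β(u)) du − E₁(t) and β(t) = β(0) − ∫₀^t γ₂(u) ∇_β g(α(u), β(u)) du − E₂(t), where E₁, E₂ are continuous noise paths that converge to finite limits as t → ∞. Suppose that for every α ∈ ℝ^{d₁}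 the ODE β̇ = −∇_β g(α, β) has a globally asymptotically stable equilibrium β*(α), with β* : ℝ^{d₁} → ℝ^{d₂} Lipschitz continuous, and that the ODE α̇ = −∇_α f(α, β*(α)) has a globally asymptotically stable equilibrium α* ∈ ℝ^{d₁}. Then (α(t), β(t)) → (α*, β*(α*)) as t → ∞; in particular lim_{t→∞} ∇_α f(α(t), β(t)) = 0 and lim_{t→∞} ∇_β g(α(t), β(t)) = 0. -/
open Filter

/-- Along an ultrafilter, an eventually bounded function into a proper space converges. -/
lemma Ultrafilter.exists_tendsto_of_bounded {ι F : Type*} [NormedAddCommGroup F] [ProperSpace F]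
    (U : Ultrafilter ι) {p : ι → F} {M : ℝ} (hp : ∀ᶠ i in (U : Filter ι), ‖p i‖ ≤ M) :
    ∃ c, ‖c‖ ≤ M ∧ Tendsto p U (nhds c) := by
  obtain ⟨c, hc, hlim⟩ := (isCompact_closedBall (0 : F) M).ultrafilter_le_nhds (U.map p)
    (le_principal_iff.2 (hp.mono fun i hi => mem_closedBall_zero_iff.2 hi))
  exact ⟨c, by simpa using hc, hlim⟩

/-- A continuous function sends asymptotically equal bounded functions to asymptotically equal
functions. -/
lemma tendsto_comp_sub_comp_zero {ι F G : Type*} [NormedAddCommGroup F] [ProperSpace F]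
    [NormedAddCommGroup G] {l : Filter ι} {W : F → G} (hW : Continuous W) {p q : ι → F} {M : ℝ}
    (hp : ∀ᶠ i in l, ‖p i‖ ≤ M) (hpq : Tendsto (fun i => p i - q i) l (nhds 0)) :
    Tendsto (fun i => W (p i) - W (q i)) l (nhds 0) := by
  rw [tendsto_iff_ultrafilter]
  intro U hU
  obtain ⟨c, -, hc⟩ := U.exists_tendsto_of_bounded (hU hp)
  have hq : Tendsto q U (nhds c) := by
    simpa using hc.sub (hpq.mono_left hU)
  simpa using ((hW.tendsto c).comp hc).sub ((hW.tendsto c).comp hq)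

section AsymptoticSolutions

variable {F : Type*} [NormedAddCommGroup F] [NormedSpace ℝ F] [ProperSpace F]

/-- A bounded asymptotic solution of `ẏ = -W(y)` satisfies the ODE at the level of difference
quotients, uniformly at large times. -/
lemma eventually_norm_increment_add_smul_le {W : F → F} (hW : Continuous W) {y w : ℝ → F} {M : ℝ}
    (hy : ∀ᶠ s in atTop, HasDerivAt y (w s) s) (hM : ∀ᶠ s in atTop, ‖y s‖ ≤ M)
    (hw : Tendsto (fun s => w s + W (y s)) atTop (nhds 0)) {ε : ℝ} (hε : 0 < ε) :
    ∃ δ > 0, ∀ᶠ s in atTop, ∀ h, |h| < δ → ‖y (s + h) - y s + h • W (y s)‖ ≤ ε * |h| := by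
  have hK : IsCompact (Metric.closedBall (0 : F) M) := isCompact_closedBall 0 M
  obtain ⟨η, hη, hunif⟩ := Metric.uniformContinuousOn_iff.1
    (hK.uniformContinuousOn_of_continuous hW.continuousOn) (ε / 2) (by positivity)
  obtain ⟨K, hWK⟩ := hK.exists_bound_of_continuousOn hW.continuousOn
  have hsmall : ∀ᶠ s in atTop, ‖w s + W (y s)‖ < min (ε / 2) 1 := by
    have := hw.norm
    rw [norm_zero] at this
    exact this.eventually_lt_const (by positivity)
  obtain ⟨a, ha⟩ := eventually_atTop.1 (hy.and (hM.and hsmall))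
  have hK1 : 0 < |K| + 1 := by positivity
  refine ⟨η / (|K| + 1), by positivity, ?_⟩
  filter_upwards [eventually_ge_atTop (a + η / (|K| + 1))] with s hs h hh
  set S := Metric.ball s (η / (|K| + 1)) with hS
  have hSa : ∀ r ∈ S, a ≤ r := fun r hr => by
    rw [hS, Metric.mem_ball, Real.dist_eq, abs_lt] at hr
    linarith
  have hsS : s ∈ S := Metric.mem_ball_self (by positivity)
  have hhS : s + h ∈ S := by simpa [hS, Real.dist_eq] using hh
  have hball : ∀ r ∈ S, y r ∈ Metric.closedBall (0 : F) M := fun r hr => by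
    simpa using (ha r (hSa r hr)).2.1
  have hwK : ∀ r ∈ S, ‖w r‖ ≤ |K| + 1 := fun r hr => by
    have h1 := hWK _ (hball r hr)
    have h2 := (ha r (hSa r hr)).2.2.le.trans (min_le_right _ _)
    have h3 : ‖w r‖ ≤ ‖w r + W (y r)‖ + ‖W (y r)‖ := norm_le_add_norm_add _ _
    linarith [le_abs_self K]
  have hclose : ∀ r ∈ S, ‖w r + W (y s)‖ ≤ ε := fun r hr => by
    have h1 : ‖y r - y s‖ ≤ (|K| + 1) * ‖r - s‖ :=
      Convex.norm_image_sub_le_of_norm_hasDerivWithin_le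
        (fun q hq => (ha q (hSa q hq)).1.hasDerivWithinAt) hwK (convex_ball _ _) hsS hr
    have h2 : (|K| + 1) * ‖r - s‖ < η := by
      rw [hS, Metric.mem_ball, dist_eq_norm, lt_div_iff₀ hK1] at hr
      linarith
    have h3 := hunif _ (hball r hr) _ (hball s hsS) (by rw [dist_eq_norm]; linarith)
    rw [dist_comm, dist_eq_norm] at h3
    have h4 := (ha r (hSa r hr)).2.2.le.trans (min_le_left _ _)
    calc ‖w r + W (y s)‖ = ‖(w r + W (y r)) + (W (y s) - W (y r))‖ := by congr 1; abel
      _ ≤ ε / 2 + ε / 2 := (norm_add_le _ _).trans (by linarith)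
      _ = ε := by ring
  have hmain := Convex.norm_image_sub_le_of_norm_hasDerivWithin_le
    (f := fun r => y r + r • W (y s)) (f' := fun r => w r + W (y s))
    (fun r hr => ((ha r (hSa r hr)).1.add
      (by simpa using (hasDerivAt_id r).smul_const (W (y s)))).hasDerivWithinAt)
    hclose (convex_ball s _) hsS hhS
  have heq : y (s + h) + (s + h) • W (y s) - (y s + s • W (y s))
      = y (s + h) - y s + h • W (y s) := by
    rw [add_smul]; abel
  simpa [heq] using hmain

/-- The translates of a bounded asymptotic solution of `ẏ = -W(y)` converge along every ultrafilter
at infinity to a bounded complete solution. -/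
lemma exists_complete_solution_of_ultrafilter {W : F → F} (hW : Continuous W) {y w : ℝ → F} {M : ℝ}
    (hy : ∀ᶠ s in atTop, HasDerivAt y (w s) s) (hM : ∀ᶠ s in atTop, ‖y s‖ ≤ M)
    (hw : Tendsto (fun s => w s + W (y s)) atTop (nhds 0))
    (U : Ultrafilter ℝ) (hU : (U : Filter ℝ) ≤ atTop) :
    ∃ z : ℝ → F, (∀ t, HasDerivAt z (-W (z t)) t) ∧ (∀ t, ‖z t‖ ≤ M) ∧
      ∀ t, Tendsto (fun s => y (s + t)) U (nhds (z t)) := by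
  have htrans : ∀ t : ℝ, Tendsto (fun s => s + t) (U : Filter ℝ) atTop := fun t =>
    (tendsto_atTop_add_const_right _ t tendsto_id).mono_left hU
  choose z hzM hz using fun t => U.exists_tendsto_of_bounded ((htrans t).eventually hM)
  refine ⟨z, fun t => ?_, hzM, hz⟩
  rw [hasDerivAt_iff_isLittleO_nhds_zero, Asymptotics.isLittleO_iff]
  intro ε hε
  obtain ⟨δ, hδ, hev⟩ := eventually_norm_increment_add_smul_le hW hy hM hw hε
  filter_upwards [Metric.ball_mem_nhds (0 : ℝ) hδ] with h hh
  have hh' : |h| < δ := by simpa using hh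
  have hlim : Tendsto (fun s => ‖y (s + (t + h)) - y (s + t) + h • W (y (s + t))‖) U
      (nhds ‖z (t + h) - z t + h • W (z t)‖) :=
    (((hz (t + h)).sub (hz t)).add (((hW.tendsto _).comp (hz t)).const_smul h)).norm
  have hle := le_of_tendsto hlim (((htrans t).eventually hev).mono fun s hs => by
    simpa [add_assoc] using hs h hh')
  simpa [sub_eq_add_neg] using hle

/-- If a continuous function vanishes on all bounded complete solutions of `ẏ = -W(y)`, then it tends
to zero along every bounded asymptotic solution. -/
lemma tendsto_zero_of_asymptotic_solution {G : Type*} [NormedAddCommGroup G]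
    {W : F → F} (hW : Continuous W) {y w : ℝ → F} {M : ℝ}
    (hy : ∀ᶠ s in atTop, HasDerivAt y (w s) s) (hM : ∀ᶠ s in atTop, ‖y s‖ ≤ M)
    (hw : Tendsto (fun s => w s + W (y s)) atTop (nhds 0))
    {H : F → G} (hH : Continuous H)
    (hzero : ∀ z : ℝ → F, (∀ t, HasDerivAt z (-W (z t)) t) → (∀ t, ‖z t‖ ≤ M) → H (z 0) = 0) :
    Tendsto (fun s => H (y s)) atTop (nhds 0) := by
  rw [tendsto_iff_ultrafilter]
  intro U hU
  obtain ⟨z, hz, hzM, hlim⟩ := exists_complete_solution_of_ultrafilter hW hy hM hw U hU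
  rw [← hzero z hz hzM]
  simpa [Function.comp_def] using (hH.tendsto _).comp (hlim 0)

/-- The inverse of a time change with positive speed `γ`. -/
lemma exists_inverse_time_change {Γ γ : ℝ → ℝ} (hγ : ∀ t, 0 < γ t)
    (hΓ : ∀ t, HasDerivAt Γ (γ t) t) (htop : Tendsto Γ atTop atTop)
    (hbot : Tendsto Γ atBot atBot) :
    ∃ θ : ℝ → ℝ, (∀ t, θ (Γ t) = t) ∧ (∀ s, HasDerivAt θ (γ (θ s))⁻¹ s) ∧
      Tendsto θ atTop atTop := by
  have hmono : StrictMono Γ := strictMono_of_deriv_pos fun t => by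
    rw [(hΓ t).deriv]; exact hγ t
  have hcont : Continuous Γ := continuous_iff_continuousAt.2 fun t => (hΓ t).continuousAt
  let e := hmono.orderIsoOfSurjective Γ (hcont.surjective htop hbot)
  refine ⟨e.symm, fun t => e.symm_apply_apply t, fun s => ?_, e.symm.tendsto_atTop⟩
  exact HasDerivAt.of_local_left_inverse e.symm.continuous.continuousAt (hΓ _) (hγ _).ne'
    (Eventually.of_forall fun r => e.apply_symm_apply r)

/-- Version of `tendsto_zero_of_asymptotic_solution` for the ODE run at speed `γ`. -/
lemma tendsto_zero_of_asymptotic_solution_of_speed {G : Type*} [NormedAddCommGroup G]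
    {Γ γ : ℝ → ℝ} (hγ : ∀ t, 0 < γ t)
    (hΓ : ∀ t, HasDerivAt Γ (γ t) t) (htop : Tendsto Γ atTop atTop)
    (hbot : Tendsto Γ atBot atBot)
    {W : F → F} (hW : Continuous W) {y v : ℝ → F} {M : ℝ}
    (hy : ∀ t, HasDerivAt y (v t) t) (hM : ∀ᶠ t in atTop, ‖y t‖ ≤ M)
    (hv : Tendsto (fun t => (γ t)⁻¹ • v t + W (y t)) atTop (nhds 0))
    {H : F → G} (hH : Continuous H)
    (hzero : ∀ z : ℝ → F, (∀ t, HasDerivAt z (-W (z t)) t) → (∀ t, ‖z t‖ ≤ M) → H (z 0) = 0) :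
    Tendsto (fun t => H (y t)) atTop (nhds 0) := by
  obtain ⟨θ, hθΓ, hθ, hθtop⟩ := exists_inverse_time_change hγ hΓ htop hbot
  have key := tendsto_zero_of_asymptotic_solution hW (y := y ∘ θ)
    (Eventually.of_forall fun s => (hy (θ s)).scomp s (hθ s))
    (hθtop.eventually hM) (hv.comp hθtop) hH hzero
  simpa [Function.comp_def, hθΓ] using key.comp htop

end AsymptoticSolutions

/-- The only bounded complete solution is the globally asymptotically stable equilibrium. -/
lemma IsGloballyAsymptoticallyStable.eq_of_bounded_complete {d : ℕ}
    {V : EuclideanSpace ℝ (Fin d) → EuclideanSpace ℝ (Fin d)} {xstar : EuclideanSpace ℝ (Fin d)}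
    (h : IsGloballyAsymptoticallyStable V xstar) (hV : Continuous V)
    {x : ℝ → EuclideanSpace ℝ (Fin d)} (hx : ∀ t, HasDerivAt x (-V (x t)) t) {M : ℝ}
    (hM : ∀ t, ‖x t‖ ≤ M) (τ : ℝ) : x τ = xstar := by
  obtain ⟨-, hattr, hstab⟩ := h
  -- The time reversal of `x` solves the reversed equation and hence has a bounded complete
  -- limit `z` at infinity, so `x` comes close to `xstar` at arbitrarily early times.
  obtain ⟨U, hU⟩ := Ultrafilter.exists_le (atTop : Filter ℝ)
  have hrev : ∀ s, HasDerivAt (fun s => x (-s)) (V (x (-s))) s := fun s => by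
    simpa [Function.comp_def] using (hx (-s)).scomp s (hasDerivAt_neg s)
  obtain ⟨z, hz, -, hlim⟩ := exists_complete_solution_of_ultrafilter hV.neg
    (Eventually.of_forall hrev) (Eventually.of_forall fun s => hM (-s)) (by simp) U hU
  have hzrev : Tendsto (fun s => z (-s)) atTop (nhds xstar) := hattr _ fun t _ => by
    simpa [Function.comp_def] using (hz (-t)).scomp t (hasDerivAt_neg t)
  rw [← sub_eq_zero, ← norm_le_zero_iff]
  refine le_of_forall_pos_le_add fun ε hε => ?_
  obtain ⟨δ, hδ, hstay⟩ := hstab ε hε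
  obtain ⟨t, ht⟩ := (hzrev.eventually (Metric.ball_mem_nhds xstar hδ)).exists
  have hnear := (hlim (-t)).eventually (Metric.isOpen_ball.mem_nhds ht)
  obtain ⟨s, hs, hsτ⟩ := (hnear.and (hU (eventually_ge_atTop (t - τ)))).exists
  have hshift := hstay (fun r => x (-(s + -t) + r))
    (fun r _ => (hx _).comp_const_add _ _)
    (by simpa [dist_eq_norm] using hs) (τ + (s - t)) (by linarith)
  have harg : -(s + -t) + (τ + (s - t)) = τ := by ring
  rw [harg] at hshift
  linarith

/-- A positive continuous step size on `[0, ∞)`, frozen at its initial value for negative times,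
has a primitive that is a time change of the whole line. -/
lemma exists_time_change {γ : ℝ → ℝ} (hpos : ∀ t ≥ (0 : ℝ), 0 < γ t)
    (hcont : ContinuousOn γ (Set.Ici (0 : ℝ)))
    (hdiv : Tendsto (fun t => ∫ u in (0 : ℝ)..t, γ u) atTop atTop) :
    ∃ Γ : ℝ → ℝ, (∀ t, HasDerivAt Γ (γ (max t 0)) t) ∧ Tendsto Γ atTop atTop ∧
      Tendsto Γ atBot atBot := by
  have hc : Continuous fun t => γ (max t 0) :=
    hcont.comp_continuous (by fun_prop) fun t => le_max_right t 0
  refine ⟨fun t => ∫ u in (0 : ℝ)..t, γ (max u 0),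
    fun t => (hc.integral_hasStrictDerivAt 0 t).hasDerivAt, hdiv.congr' ?_,
    (tendsto_id.atBot_mul_const (hpos 0 le_rfl)).congr' ?_⟩
  · filter_upwards [eventually_ge_atTop 0] with t ht
    refine intervalIntegral.integral_congr fun u hu => ?_
    rw [Set.uIcc_of_le ht] at hu
    simp [hu.1]
  · filter_upwards [eventually_le_atBot 0] with t ht
    have : ∫ u in (0 : ℝ)..t, γ (max u 0) = ∫ _ in (0 : ℝ)..t, γ 0 := by
      refine intervalIntegral.integral_congr fun u hu => ?_
      rw [Set.uIcc_of_ge ht] at hu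
      simp [hu.2]
    simp [this]

/-- Removing a convergent noise path from a path driven by `-γ V` leaves an asymptotically equal
path that is differentiable. -/
lemma exists_differentiable_path {d : ℕ} {γ : ℝ → ℝ} {x V E : ℝ → EuclideanSpace ℝ (Fin d)}
    {l : EuclideanSpace ℝ (Fin d)} (hγ : ContinuousOn γ (Set.Ici (0 : ℝ)))
    (hV : ContinuousOn V (Set.Ici (0 : ℝ))) (hE : Tendsto E atTop (nhds l))
    (hx : ∀ t ≥ (0 : ℝ), x t = x 0 - (∫ u in (0 : ℝ)..t, γ u • V u) - E t) :
    ∃ y : ℝ → EuclideanSpace ℝ (Fin d),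
      (∀ t, HasDerivAt y (-(γ (max t 0) • V (max t 0))) t) ∧
      Tendsto (fun t => x t - y t) atTop (nhds 0) := by
  have hc : Continuous fun t => γ (max t 0) • V (max t 0) :=
    (hγ.smul hV).comp_continuous (by fun_prop) fun t => le_max_right t 0
  refine ⟨fun t => x 0 - l - ∫ u in (0 : ℝ)..t, γ (max u 0) • V (max u 0),
    fun t => (hc.integral_hasStrictDerivAt 0 t).hasDerivAt.const_sub _, ?_⟩
  have hlim : Tendsto (fun t => l - E t) atTop (nhds 0) := by
    simpa using hE.const_sub l
  refine hlim.congr' ?_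
  filter_upwards [eventually_ge_atTop 0] with t ht
  have : ∫ u in (0 : ℝ)..t, γ (max u 0) • V (max u 0) = ∫ u in (0 : ℝ)..t, γ u • V u := by
    refine intervalIntegral.integral_congr fun u hu => ?_
    rw [Set.uIcc_of_le ht] at hu
    simp [hu.1]
  rw [this, hx t ht]
  abel

theorem stmt11 {d₁ d₂ : ℕ} (hd₁ : 1 ≤ d₁) (hd₂ : 1 ≤ d₂)
    (f g : EuclideanSpace ℝ (Fin d₁) × EuclideanSpace ℝ (Fin d₂) → ℝ)
    (hf : ContDiff ℝ 1 f) (hg : ContDiff ℝ 1 g)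
    (hfLip : LocallyLipschitz (fun p :
      EuclideanSpace ℝ (Fin d₁) × EuclideanSpace ℝ (Fin d₂) => gradFst f p.1 p.2))
    (hgLip : LocallyLipschitz (fun p :
      EuclideanSpace ℝ (Fin d₁) × EuclideanSpace ℝ (Fin d₂) => gradSnd g p.1 p.2))
    (γ₁ γ₂ : ℝ → ℝ)
    (hγ₁pos : ∀ t ≥ (0:ℝ), 0 < γ₁ t) (hγ₂pos : ∀ t ≥ (0:ℝ), 0 < γ₂ t)
    (hγ₁anti : AntitoneOn γ₁ (Set.Ici (0:ℝ))) (hγ₂anti : AntitoneOn γ₂ (Set.Ici (0:ℝ)))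
    (hγ₁cont : ContinuousOn γ₁ (Set.Ici (0:ℝ))) (hγ₂cont : ContinuousOn γ₂ (Set.Ici (0:ℝ)))
    (hγ₁lim : Tendsto γ₁ atTop (nhds 0)) (hγ₂lim : Tendsto γ₂ atTop (nhds 0))
    (hratio : Tendsto (fun t => γ₁ t / γ₂ t) atTop (nhds 0))
    (hγ₁div : Tendsto (fun t => ∫ u in (0:ℝ)..t, γ₁ u) atTop atTop)
    (hγ₂div : Tendsto (fun t => ∫ u in (0:ℝ)..t, γ₂ u) atTop atTop)
    (α : ℝ → EuclideanSpace ℝ (Fin d₁)) (β : ℝ → EuclideanSpace ℝ (Fin d₂))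
    (hαcont : ContinuousOn α (Set.Ici (0:ℝ))) (hβcont : ContinuousOn β (Set.Ici (0:ℝ)))
    (hbdd : ∃ M : ℝ, ∀ t ≥ (0:ℝ), ‖α t‖ + ‖β t‖ ≤ M)
    (E₁ : ℝ → EuclideanSpace ℝ (Fin d₁)) (E₂ : ℝ → EuclideanSpace ℝ (Fin d₂))
    (hE₁cont : Continuous E₁) (hE₂cont : Continuous E₂)
    (hE₁lim : ∃ l₁, Tendsto E₁ atTop (nhds l₁))
    (hE₂lim : ∃ l₂, Tendsto E₂ atTop (nhds l₂))
    (hαeq : ∀ t ≥ (0:ℝ),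
      α t = α 0 - (∫ u in (0:ℝ)..t, γ₁ u • gradFst f (α u) (β u)) - E₁ t)
    (hβeq : ∀ t ≥ (0:ℝ),
      β t = β 0 - (∫ u in (0:ℝ)..t, γ₂ u • gradSnd g (α u) (β u)) - E₂ t)
    (bstar : EuclideanSpace ℝ (Fin d₁) → EuclideanSpace ℝ (Fin d₂))
    (hGAS : ∀ a, IsGloballyAsymptoticallyStable (fun b => gradSnd g a b) (bstar a))
    (hbstarLip : ∃ Λ : NNReal, LipschitzWith Λ bstar)
    (astar : EuclideanSpace ℝ (Fin d₁))
    (hGASslow : IsGloballyAsymptoticallyStable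
      (fun a => gradFst f a (bstar a)) astar) :
    Tendsto α atTop (nhds astar) ∧
    Tendsto β atTop (nhds (bstar astar)) ∧
    Tendsto (fun t => gradFst f (α t) (β t)) atTop (nhds 0) ∧
    Tendsto (fun t => gradSnd g (α t) (β t)) atTop (nhds 0) := by
  set V₁ := fun p : EuclideanSpace ℝ (Fin d₁) × EuclideanSpace ℝ (Fin d₂) => gradFst f p.1 p.2
  set V₂ := fun p : EuclideanSpace ℝ (Fin d₁) × EuclideanSpace ℝ (Fin d₂) => gradSnd g p.1 p.2
  have hV₁ : Continuous V₁ := hfLip.continuous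
  have hV₂ : Continuous V₂ := hgLip.continuous
  obtain ⟨Λ, hΛ⟩ := hbstarLip
  have hb : Continuous bstar := hΛ.continuous
  obtain ⟨l₁, hl₁⟩ := hE₁lim
  obtain ⟨l₂, hl₂⟩ := hE₂lim
  obtain ⟨M, hM⟩ := hbdd
  obtain ⟨Γ₁, hΓ₁, hΓ₁top, hΓ₁bot⟩ := exists_time_change hγ₁pos hγ₁cont hγ₁div
  obtain ⟨Γ₂, hΓ₂, hΓ₂top, hΓ₂bot⟩ := exists_time_change hγ₂pos hγ₂cont hγ₂div
  have hpath := hαcont.prodMk hβcont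
  obtain ⟨A, hA, hαA⟩ := exists_differentiable_path hγ₁cont (hV₁.comp_continuousOn hpath) hl₁ hαeq
  obtain ⟨B, hB, hβB⟩ := exists_differentiable_path hγ₂cont (hV₂.comp_continuousOn hpath) hl₂ hβeq
  have hmax : ∀ᶠ t : ℝ in atTop, max t 0 = t := by
    filter_upwards [eventually_ge_atTop 0] with t ht using max_eq_left ht
  have hαβM : ∀ᶠ t in atTop, ‖(α t, β t)‖ ≤ M := by
    filter_upwards [eventually_ge_atTop 0] with t ht
    have := hM t ht
    exact max_le (by linarith [norm_nonneg (β t)]) (by linarith [norm_nonneg (α t)])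
  have hdiff : Tendsto (fun t => (α t, β t) - (A t, B t)) atTop (nhds 0) := hαA.prodMk_nhds hβB
  have hABM : ∀ᶠ t in atTop, ‖(A t, B t)‖ ≤ M + 1 := by
    have h1 : ∀ᶠ t in atTop, ‖(α t, β t) - (A t, B t)‖ < 1 := by
      have := hdiff.norm
      rw [norm_zero] at this
      exact this.eventually_lt_const one_pos
    filter_upwards [h1, hαβM] with t h1 h2
    have := norm_le_norm_add_norm_sub (α t, β t) (A t, B t)
    linarith
  -- On the fast time scale, `B` tracks `bstar ∘ A`.
  have hfast : Tendsto (fun t => B t - bstar (A t)) atTop (nhds 0) := by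
    refine tendsto_zero_of_asymptotic_solution_of_speed (fun t => hγ₂pos _ (le_max_right t 0))
      hΓ₂ hΓ₂top hΓ₂bot (W := fun p => (0, V₂ p)) (by fun_prop)
      (fun t => (hA t).prodMk (hB t)) hABM ?_
      (H := fun p => p.2 - bstar p.1) (by fun_prop) ?_
    · have hbound : IsBoundedUnder (· ≤ ·) atTop (norm ∘ fun t => V₁ (α t, β t)) := by
        obtain ⟨K, hK⟩ := (isCompact_closedBall _ M).exists_bound_of_continuousOn
          (s := Metric.closedBall 0 M) hV₁.continuousOn
        exact isBoundedUnder_of_eventually_le (a := K)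
          (hαβM.mono fun t ht => hK _ (mem_closedBall_zero_iff.2 ht))
      have hslow := (hratio.zero_smul_isBoundedUnder_le hbound).neg
      have herr := (tendsto_comp_sub_comp_zero hV₂ hαβM hdiff).neg
      rw [neg_zero] at hslow herr
      refine (hslow.prodMk_nhds herr).congr' ?_
      filter_upwards [hmax, eventually_ge_atTop 0] with t ht ht0
      have hne : γ₂ t ≠ 0 := (hγ₂pos t ht0).ne'
      ext1
      · simp [ht, smul_smul, div_eq_inv_mul]
      · simp [ht, smul_smul, hne, sub_eq_add_neg, add_comm]
    · intro z hz hzM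
      have hz₁ : ∀ t, HasDerivAt (fun t => (z t).1) 0 t := fun t => by
        simpa [Function.comp_def] using (hasFDerivAt_fst (p := z t)).comp_hasDerivAt t (hz t)
      have hz₂ : ∀ t, HasDerivAt (fun t => (z t).2) (-V₂ (z t)) t := fun t => by
        simpa [Function.comp_def] using (hasFDerivAt_snd (p := z t)).comp_hasDerivAt t (hz t)
      have hconst : ∀ t, (z t).1 = (z 0).1 := fun t =>
        is_const_of_deriv_eq_zero (fun t => (hz₁ t).differentiableAt) (fun t => (hz₁ t).deriv) t 0
      refine sub_eq_zero.2 ((hGAS (z 0).1).eq_of_bounded_complete (x := fun t => (z t).2)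
        (hV₂.comp (by fun_prop : Continuous fun b => ((z 0).1, b))) (fun t => ?_)
        (fun t => (norm_snd_le _).trans (hzM t)) 0)
      simpa [V₂, hconst t] using hz₂ t
  -- On the slow time scale, `A` therefore solves the averaged equation asymptotically.
  have hslow : Tendsto (fun t => A t - astar) atTop (nhds 0) := by
    have hVb : Continuous fun a => V₁ (a, bstar a) := by fun_prop
    refine tendsto_zero_of_asymptotic_solution_of_speed (fun t => hγ₁pos _ (le_max_right t 0))
      hΓ₁ hΓ₁top hΓ₁bot hVb hA (hABM.mono fun t ht => (norm_fst_le _).trans ht) ?_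
      (H := fun a => a - astar) (by fun_prop)
      fun z hz hzM => sub_eq_zero.2 (hGASslow.eq_of_bounded_complete hVb hz hzM 0)
    have hdist : Tendsto (fun t => (α t, β t) - (A t, bstar (A t))) atTop (nhds 0) := by
      refine (hαA.prodMk_nhds (by simpa using hβB.add hfast)).congr fun t => ?_
      simp
    have herr := (tendsto_comp_sub_comp_zero hV₁ hαβM hdist).neg
    rw [neg_zero] at herr
    refine herr.congr' ?_
    filter_upwards [hmax, eventually_ge_atTop 0] with t ht ht0
    have hne : γ₁ t ≠ 0 := (hγ₁pos t ht0).ne'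
    simp [ht, smul_smul, hne, sub_eq_add_neg, add_comm]
  have hAlim : Tendsto A atTop (nhds astar) := by simpa using hslow.add_const astar
  have hBlim : Tendsto B atTop (nhds (bstar astar)) := by
    have hbA : Tendsto (fun t => bstar (A t)) atTop (nhds (bstar astar)) :=
      (hb.tendsto astar).comp hAlim
    simpa using hfast.add hbA
  have hαlim : Tendsto α atTop (nhds astar) := by simpa using hαA.add hAlim
  have hβlim : Tendsto β atTop (nhds (bstar astar)) := by simpa using hβB.add hBlim
  have hlim := hαlim.prodMk_nhds hβlim
  refine ⟨hαlim, hβlim, ?_, ?_⟩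
  · rw [← hGASslow.1]
    exact (hV₁.tendsto _).comp hlim
  · rw [← (hGAS astar).1]
    exact (hV₂.tendsto _).comp hlim
end
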